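/- arXiv:2106.08916 — 9 statements merged into one kernel-verified Lean document; each statement's English description precedes it below -/
import Mathlib

section
/- Assume g > 0, Δ > 0 and Δ² + 4g² = 2 (the constraint P₁^{(1,1/2)}((2g)², Δ²) = 0 guaranteeing the Juddian eigenvalue 3/2 − g² for ℓ = 1, N = 1). Then the pair Ψ = (ψ₁, ψ₂) with ψ₁(z) = e^{−gz}(z + (1−g²)/g) and ψ₂(z) = e^{−gz}·Δ/(2g) satisfies H₁Ψ = (3/2 − g²)·Ψ, i.e. it is an eigenfunction of the Bargmann realization of the ℓ = 1 asymmetric quantum Rabi Hamiltonian with eigenvalue 3/2 − g². -/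
open Complex

/-- The Bargmann realization of the `ℓ = 1` asymmetric quantum Rabi Hamiltonian,
acting on pairs of entire functions `ℂ → ℂ`. -/
noncomputable def H1 (g Δ : ℝ) (F : (ℂ → ℂ) × (ℂ → ℂ)) : (ℂ → ℂ) × (ℂ → ℂ) :=
  (fun z => z * deriv F.1 z + (g : ℂ) * (z * F.1 z + deriv F.1 z)
      + (1 / 2 : ℂ) * F.1 z + (Δ : ℂ) * F.2 z,
   fun z => (Δ : ℂ) * F.1 z + z * deriv F.2 z - (g : ℂ) * (z * F.2 z + deriv F.2 z)
      - (1 / 2 : ℂ) * F.2 z)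

/-- The Juddian eigenfunction `Ψ = (ψ₁, ψ₂)` for `ℓ = 1`, `N = 1`:
`ψ₁(z) = e^{-gz}(z + (1 - g²)/g)` and `ψ₂(z) = e^{-gz} Δ/(2g)`. -/
noncomputable def Psi (g Δ : ℝ) : (ℂ → ℂ) × (ℂ → ℂ) :=
  (fun z => Complex.exp (-((g : ℂ) * z)) * (z + (1 - (g : ℂ) ^ 2) / (g : ℂ)),
   fun z => Complex.exp (-((g : ℂ) * z)) * ((Δ : ℂ) / (2 * (g : ℂ))))

/-- The derivative of `z ↦ e^{-az}(z + c)`. -/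
theorem deriv_exp_neg_mul_mul_add (a c z : ℂ) :
    deriv (fun z => Complex.exp (-(a * z)) * (z + c)) z =
      Complex.exp (-(a * z)) * (1 - a * (z + c)) := by
  have h := (((hasDerivAt_id z).const_mul a).neg.cexp).mul ((hasDerivAt_id z).add_const c)
  refine (h.congr_deriv ?_).deriv
  simp only [id, Pi.neg_apply]
  ring

/-- The derivative of `z ↦ e^{-az} d`. -/
theorem deriv_exp_neg_mul_mul_const (a d z : ℂ) :
    deriv (fun z => Complex.exp (-(a * z)) * d) z = Complex.exp (-(a * z)) * (-a * d) := by
  have h := (((hasDerivAt_id z).const_mul a).neg.cexp).mul_const d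
  refine (h.congr_deriv ?_).deriv
  simp only [id, Pi.neg_apply]
  ring

/-- Under the constraint `Δ² + 4g² = 2`, the pair `Ψ` is an eigenfunction of `H₁`
with eigenvalue `3/2 - g²`. -/
theorem stmt1 (g Δ : ℝ) (hg : 0 < g) (hΔ : 0 < Δ) (hc : Δ ^ 2 + 4 * g ^ 2 = 2) :
    H1 g Δ (Psi g Δ) = ((3 / 2 - (g : ℂ) ^ 2) • (Psi g Δ).1,
      (3 / 2 - (g : ℂ) ^ 2) • (Psi g Δ).2) := by
  have hg' : (g : ℂ) ≠ 0 := by exact_mod_cast hg.ne'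
  have hc' : (Δ : ℂ) ^ 2 + 4 * (g : ℂ) ^ 2 = 2 := by exact_mod_cast hc
  refine Prod.ext (funext fun z => ?_) (funext fun z => ?_)
  · simp only [H1, Psi, Pi.smul_apply, smul_eq_mul, deriv_exp_neg_mul_mul_add]
    field_simp
    linear_combination hc'
  · simp only [H1, Psi, Pi.smul_apply, smul_eq_mul, deriv_exp_neg_mul_mul_const]
    field_simp
    ring
end

section
/- Assume g > 0, Δ > 0 and Δ² + 4g² = 2. Then the Juddian eigenfunction Ψ = (ψ₁, ψ₂) for ℓ = 1, N = 1 satisfies J₁(J₁Ψ) = (8g² + Δ²)·Ψ. (The hidden symmetry operator J₁ maps Ψ to a multiple of the second Juddian solution and back, with the product of the two proportionality constants equal to p₁(3/2 − g²; g, Δ) = 8g² + Δ².) -/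
open Complex

/-- The hidden symmetry operator `J₁` in the Bargmann picture. -/
noncomputable def J1 (g Δ : ℝ) (F : (ℂ → ℂ) × (ℂ → ℂ)) : (ℂ → ℂ) × (ℂ → ℂ) :=
  (fun z => (Δ : ℂ) * F.1 (-z) + 2 * (g : ℂ) * ((g : ℂ) * F.2 (-z) - deriv F.2 (-z)),
   fun z => 2 * (g : ℂ) * ((g : ℂ) - z) * F.1 (-z) + (Δ : ℂ) * F.2 (-z))

theorem deriv_exp_mul_mul (c : ℂ) {p : ℂ → ℂ} {p' z : ℂ} (hp : HasDerivAt p p' z) :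
    deriv (fun w => exp (c * w) * p w) z = exp (c * z) * (c * p z + p') := by
  have he : HasDerivAt (fun w : ℂ => exp (c * w)) (exp (c * z) * c) z := by
    simpa using ((hasDerivAt_id z).const_mul c).cexp
  exact (he.mul hp).deriv.trans (by ring)

/-- The image of `Ψ` under `J₁`, a solution of the form `exp (g z)` times polynomials. -/
theorem J1_Psi (g Δ : ℝ) (hg : g ≠ 0) (hc : Δ ^ 2 + 4 * g ^ 2 = 2) :
    J1 g Δ (Psi g Δ) =
      (fun z => exp ((g : ℂ) * z) * (Δ * (-z + (1 + (g : ℂ) ^ 2) / g)),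
       fun z => exp ((g : ℂ) * z) * (2 * g * z ^ 2 - 2 * z + 1 / g - 2 * (g : ℂ) ^ 3)) := by
  have hg' : (g : ℂ) ≠ 0 := by exact_mod_cast hg
  have hc' : (Δ : ℂ) ^ 2 + 4 * (g : ℂ) ^ 2 = 2 := by exact_mod_cast hc
  ext z
  · have hd := deriv_exp_mul_mul (-g) (hasDerivAt_const (-z) ((Δ : ℂ) / (2 * g)))
    simp only [neg_mul, mul_neg, neg_neg] at hd
    simp only [J1, Psi, hd, mul_neg, neg_neg]
    field_simp
    ring
  · simp only [J1, Psi, mul_neg, neg_neg]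
    field_simp
    linear_combination hc'

/-- Under the constraint `Δ² + 4g² = 2`, the Juddian eigenfunction `Ψ` satisfies
`J₁(J₁ Ψ) = (8g² + Δ²) Ψ`. -/
theorem stmt2 (g Δ : ℝ) (hg : 0 < g) (hΔ : 0 < Δ) (hc : Δ ^ 2 + 4 * g ^ 2 = 2) :
    J1 g Δ (J1 g Δ (Psi g Δ)) = (8 * (g : ℂ) ^ 2 + (Δ : ℂ) ^ 2) • Psi g Δ := by
  have hg' : (g : ℂ) ≠ 0 := by exact_mod_cast hg.ne'
  have hc' : (Δ : ℂ) ^ 2 + 4 * (g : ℂ) ^ 2 = 2 := by exact_mod_cast hc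
  rw [J1_Psi g Δ hg.ne' hc]
  ext z
  · have hp : HasDerivAt (fun w : ℂ => 2 * g * w ^ 2 - 2 * w + 1 / g - 2 * (g : ℂ) ^ 3)
        (-(4 * g * z) - 2) (-z) := by
      refine (((((hasDerivAt_id (-z)).pow 2).const_mul (2 * (g : ℂ))).sub
        ((hasDerivAt_id (-z)).const_mul 2)).add_const (1 / (g : ℂ))).sub_const
        (2 * (g : ℂ) ^ 3) |>.congr_deriv ?_
      norm_num
      ring
    have hd := deriv_exp_mul_mul g hp
    simp only [mul_neg] at hd
    simp only [J1, Psi, hd, mul_neg, neg_neg, Prod.smul_fst, Pi.smul_apply, smul_eq_mul]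
    field_simp
    linear_combination 2 * (g : ℂ) ^ 2 * hc'
  · simp only [J1, Psi, mul_neg, neg_neg, Prod.smul_snd, Pi.smul_apply, smul_eq_mul]
    field_simp
    linear_combination -(Δ : ℂ) * hc'
end

section
/- For all real g and Δ, the linear operators H₂ and J₂ on ℝ[z] ⊕ ℝ[z] commute: H₂ ∘ J₂ = J₂ ∘ H₂. (The hidden symmetry of the asymmetric quantum Rabi model with bias ℓ = 2.) -/
open Polynomial

/-- The parity operator `(𝒫 f)(z) = f(-z)` on real polynomials. -/
noncomputable def Par (f : Polynomial ℝ) : Polynomial ℝ := f.comp (-Polynomial.X)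

/-- Bargmann realization of `H̃₂ = a†a + Δσₓ + g(a+a†)σ_z + σ_z`
on `ℝ[z] ⊕ ℝ[z]`. -/
noncomputable def H2 (g Δ : ℝ) (F : Polynomial ℝ × Polynomial ℝ) :
    Polynomial ℝ × Polynomial ℝ :=
  (Polynomial.X * derivative F.1 + C g * (Polynomial.X * F.1 + derivative F.1)
      + F.1 + C Δ * F.2,
   C Δ * F.1 + Polynomial.X * derivative F.2 - C g * (Polynomial.X * F.2 + derivative F.2)
      - F.2)

/-- The hidden symmetry operator `J₂ = 𝒫 [[α, β],[γ, δ]]` on `ℝ[z] ⊕ ℝ[z]`, with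
`α = Δ(2gz − 2g∂ + 4g² + 1)`, `β = 4g²∂² − 8g³∂ + (4g⁴ + Δ²)`,
`γ = 4g²z² + 8g³z + (4g⁴ + Δ²)`, `δ = Δ(2gz − 2g∂ + 4g² − 1)`. -/
noncomputable def J2 (g Δ : ℝ) (F : Polynomial ℝ × Polynomial ℝ) :
    Polynomial ℝ × Polynomial ℝ :=
  (Par (C Δ * (C (2 * g) * Polynomial.X * F.1 - C (2 * g) * derivative F.1
          + C (4 * g ^ 2 + 1) * F.1)
      + (C (4 * g ^ 2) * derivative (derivative F.2) - C (8 * g ^ 3) * derivative F.2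
          + C (4 * g ^ 4 + Δ ^ 2) * F.2)),
   Par ((C (4 * g ^ 2) * Polynomial.X ^ 2 * F.1 + C (8 * g ^ 3) * Polynomial.X * F.1
          + C (4 * g ^ 4 + Δ ^ 2) * F.1)
      + C Δ * (C (2 * g) * Polynomial.X * F.2 - C (2 * g) * derivative F.2
          + C (4 * g ^ 2 - 1) * F.2)))

/-- The hidden symmetry of the asymmetric quantum Rabi model with bias `ℓ = 2`:
`H₂` and `J₂` commute. -/
theorem stmt6 (g Δ : ℝ) : H2 g Δ ∘ J2 g Δ = J2 g Δ ∘ H2 g Δ := by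
  funext ⟨p, q⟩
  ext1 <;>
  · simp only [Function.comp_apply, H2, J2, Par, derivative_comp, derivative_add, derivative_sub,
      derivative_mul, derivative_neg, derivative_X, derivative_C, sq (X : ℝ[X]), derivative_one,
      derivative_zero, add_comp, sub_comp, mul_comp, X_comp, C_comp,
      one_comp, zero_comp]
    simp only [C_mul, C_add, C_sub, C_pow, C_1, map_ofNat]
    ring
end

section
/- For all real g and Δ, the hidden symmetry operator for bias ℓ = 2 satisfies the quadratic relation J₂ ∘ J₂ = 16g⁴·H₂² + 8g²(Δ² + 4g⁴ + 2g²)·H₂ + (Δ⁴ + Δ² + 8Δ²g⁴ + 4Δ²g² + 16g⁸ + 16g⁶)·id on ℝ[z] ⊕ ℝ[z]; that is, J₂² = p₂(H₂; g, Δ) with p₂(x; g, Δ) = 16g⁴x² + 8g²(Δ² + 4g⁴ + 2g²)x + Δ⁴ + Δ² + 8Δ²g⁴ + 4Δ²g² + 16g⁸ + 16g⁶. -/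
open Polynomial

theorem par_zero : Par 0 = 0 := zero_comp

theorem par_one : Par 1 = 1 := one_comp

theorem par_add (p q : Polynomial ℝ) : Par (p + q) = Par p + Par q := add_comp

theorem par_sub (p q : Polynomial ℝ) : Par (p - q) = Par p - Par q := sub_comp

theorem par_neg (p : Polynomial ℝ) : Par (-p) = -Par p := neg_comp

theorem par_mul (p q : Polynomial ℝ) : Par (p * q) = Par p * Par q := mul_comp p q _

theorem par_C (a : ℝ) : Par (C a) = C a := C_comp

theorem par_X : Par Polynomial.X = -Polynomial.X := X_comp

theorem par_par (p : Polynomial ℝ) : Par (Par p) = p := by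
  simp [Par, comp_assoc]

theorem derivative_par (p : Polynomial ℝ) : derivative (Par p) = -Par (derivative p) := by
  simp [Par, derivative_comp]

/-- Quadratic relation `J₂² = p₂(H₂; g, Δ)` with
`p₂(x; g, Δ) = 16g⁴x² + 8g²(Δ² + 4g⁴ + 2g²)x + Δ⁴ + Δ² + 8Δ²g⁴ + 4Δ²g² + 16g⁸ + 16g⁶`. -/
theorem stmt7 (g Δ : ℝ) :
    J2 g Δ ∘ J2 g Δ
      = fun F => (16 * g ^ 4) • H2 g Δ (H2 g Δ F)
          + (8 * g ^ 2 * (Δ ^ 2 + 4 * g ^ 4 + 2 * g ^ 2)) • H2 g Δ F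
          + (Δ ^ 4 + Δ ^ 2 + 8 * Δ ^ 2 * g ^ 4 + 4 * Δ ^ 2 * g ^ 2
              + 16 * g ^ 8 + 16 * g ^ 6) • F := by
  funext F
  obtain ⟨p, q⟩ := F
  refine Prod.ext ?_ ?_ <;>
  · simp only [Function.comp_apply, J2, H2, Prod.fst_add, Prod.snd_add, Prod.smul_fst,
      Prod.smul_snd, par_add, par_sub, par_neg, par_mul, par_C, par_X, par_par,
      derivative_par, derivative_add, derivative_sub, derivative_neg, derivative_mul,
      derivative_C, derivative_X, sq, derivative_one,
      derivative_zero, par_zero, par_one, smul_eq_C_mul]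
    simp only [map_add, map_sub, map_mul, map_pow, map_ofNat, map_one]
    ring
end

section
/- For every ℓ, N ∈ ℕ and all real g, Δ: A_N^ℓ((2g)², Δ²) = det(Δ²·I_ℓ + M_ℓ(N + ℓ/2 − g², g)). In other words, evaluating the determinant expression det(Δ²·I_ℓ + M_ℓ(x, g)) at the exceptional baselines x = N + ℓ/2 − g² recovers the quotient polynomials A_N^ℓ of the constraint polynomials of the asymmetric quantum Rabi model. -/
/-- The `ℓ×ℓ` tridiagonal matrix `M_ℓ(x, g)` (rows and columns indexed by `Fin ℓ`,
corresponding to the 1-based index `i = ↑i + 1`). -/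
noncomputable def Mmat (ℓ : ℕ) (x g : ℝ) : Matrix (Fin ℓ) (Fin ℓ) ℝ :=
  Matrix.of fun i j =>
    if (i : ℕ) = (j : ℕ) then
      ((2 * g) ^ 2 - (ℓ : ℝ) + 2 * (((i : ℕ) : ℝ) + 1) - 1)
        * (x - (ℓ : ℝ) / 2 + g ^ 2 + (((i : ℕ) : ℝ) + 1))
    else if (j : ℕ) = (i : ℕ) + 1 then
      x - (ℓ : ℝ) / 2 + g ^ 2 + (((i : ℕ) : ℝ) + 1)
    else if (i : ℕ) = (j : ℕ) + 1 then
      -((((j : ℕ) : ℝ) + 1) * ((ℓ : ℝ) - (((j : ℕ) : ℝ) + 1)))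
        * (x - (ℓ : ℝ) / 2 + g ^ 2 + (((j : ℕ) : ℝ) + 1) + 1)
    else 0

/-- The quotient `A_N^ℓ(u, v)` of constraint polynomials, via its tridiagonal
determinant expression. -/
noncomputable def Apoly (ℓ N : ℕ) (u v : ℝ) : ℝ :=
  (((N + ℓ).factorial : ℝ) / (N.factorial : ℝ)) *
    (Matrix.of fun i j : Fin ℓ =>
      if (i : ℕ) = (j : ℕ) then
        u + v / ((N : ℝ) + (((i : ℕ) : ℝ) + 1)) - (ℓ : ℝ) + 2 * (((i : ℕ) : ℝ) + 1) - 1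
      else if (j : ℕ) = (i : ℕ) + 1 then 1
      else if (i : ℕ) = (j : ℕ) + 1 then
        -((((j : ℕ) : ℝ) + 1) * ((ℓ : ℝ) - (((j : ℕ) : ℝ) + 1)))
      else 0).det

/-- The factorial quotient `(N+ℓ)!/N!` is the product `(N+1)⋯(N+ℓ)`. -/
theorem factorial_div_factorial_eq_prod_fin (ℓ N : ℕ) :
    ((N + ℓ).factorial : ℝ) / (N.factorial : ℝ)
      = ∏ i : Fin ℓ, ((N : ℝ) + (((i : ℕ) : ℝ) + 1)) := by
  rw [Fin.prod_univ_eq_prod_range (fun i : ℕ => (N : ℝ) + ((i : ℝ) + 1)) ℓ,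
    div_eq_iff (by positivity)]
  induction ℓ with
  | zero => simp
  | succ k ih =>
    rw [← add_assoc, Nat.factorial_succ, Finset.prod_range_succ, Nat.cast_mul, ih]
    push_cast
    ring

/-- Evaluating `det(Δ²·I_ℓ + M_ℓ(x, g))` at the exceptional baseline
`x = N + ℓ/2 − g²` recovers `A_N^ℓ((2g)², Δ²)`. -/
theorem stmt8 (ℓ N : ℕ) (g Δ : ℝ) :
    Apoly ℓ N ((2 * g) ^ 2) (Δ ^ 2)
      = (Δ ^ 2 • (1 : Matrix (Fin ℓ) (Fin ℓ) ℝ)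
          + Mmat ℓ ((N : ℝ) + (ℓ : ℝ) / 2 - g ^ 2) g).det := by
  rw [Apoly, factorial_div_factorial_eq_prod_fin, ← Matrix.det_mul_column]
  congr 1
  ext i j
  have hi : (N : ℝ) + (((i : ℕ) : ℝ) + 1) ≠ 0 := by positivity
  simp only [Mmat, Matrix.of_apply, Matrix.add_apply, Matrix.smul_apply, Matrix.one_apply,
    smul_eq_mul, Fin.ext_iff]
  split_ifs with hdiag hsup hsub
  · field_simp
    ring
  · ring
  · rw [hsub]
    push_cast
    ring
  · ring
end

section
/- Fix ℓ ∈ ℕ and real g, Δ. Suppose p is a real polynomial in one variable of degree at most ℓ such that p(N + ℓ/2 − g²) = A_N^ℓ((2g)², Δ²) for every integer N with 0 ≤ N ≤ ℓ. Then p(x) = det(Δ²·I_ℓ + M_ℓ(x, g)) for every real x. (Determinant expression for the polynomial p_ℓ in the quadratic relation J_ℓ² = p_ℓ(H_ℓ; g, Δ), conditional on the conjecture p_ℓ(N + ℓ/2 − g²; g, Δ) = A_N^ℓ((2g)², Δ²).) -/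
theorem Mmat_eq_affine (ℓ : ℕ) (g x : ℝ) :
    Mmat ℓ x g = x • (Mmat ℓ 1 g - Mmat ℓ 0 g) + Mmat ℓ 0 g := by
  ext i j
  simp only [Mmat, Matrix.add_apply, Matrix.smul_apply, Matrix.sub_apply, Matrix.of_apply,
    smul_eq_mul]
  split_ifs <;> ring

/-- `det (B + M_ℓ(x, g))` is a polynomial in `x` of degree at most `ℓ`. -/
theorem exists_polynomial_eval_eq_det_add_Mmat (ℓ : ℕ) (g : ℝ) (B : Matrix (Fin ℓ) (Fin ℓ) ℝ) :
    ∃ q : Polynomial ℝ, q.natDegree ≤ ℓ ∧ ∀ x : ℝ, q.eval x = (B + Mmat ℓ x g).det := by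
  refine ⟨((Polynomial.X : Polynomial ℝ) • (Mmat ℓ 1 g - Mmat ℓ 0 g).map Polynomial.C
    + (B + Mmat ℓ 0 g).map Polynomial.C).det, ?_, fun x => ?_⟩
  · simpa using Polynomial.natDegree_det_X_add_C_le (Mmat ℓ 1 g - Mmat ℓ 0 g) (B + Mmat ℓ 0 g)
  · rw [← Polynomial.coe_evalRingHom, RingHom.map_det, Mmat_eq_affine ℓ g x]
    congr 1
    ext i j
    simp
    ring

theorem Apoly_eq_det (ℓ N : ℕ) (g v : ℝ) :
    Apoly ℓ N ((2 * g) ^ 2) v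
      = (v • (1 : Matrix (Fin ℓ) (Fin ℓ) ℝ) + Mmat ℓ ((N : ℝ) + (ℓ : ℝ) / 2 - g ^ 2) g).det := by
  have hprod : ((N + ℓ).factorial : ℝ) / (N.factorial : ℝ)
      = ∏ i : Fin ℓ, ((N : ℝ) + (((i : ℕ) : ℝ) + 1)) := by
    rw [div_eq_iff (by positivity), ← Nat.factorial_mul_ascFactorial,
      Nat.ascFactorial_eq_prod_range, Finset.prod_range]
    push_cast
    rw [mul_comm]
    congr 1
    exact Finset.prod_congr rfl fun i _ => by ring
  rw [Apoly, hprod, ← Matrix.det_mul_column]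
  congr 1
  ext i j
  have hi : (N : ℝ) + (((i : ℕ) : ℝ) + 1) ≠ 0 := by positivity
  simp only [Mmat, Matrix.add_apply, Matrix.smul_apply, Matrix.of_apply, smul_eq_mul,
    Matrix.one_apply, Fin.ext_iff]
  split_ifs with h₁ h₂ h₃
  · field_simp
    ring
  · ring
  · rw [h₃]
    push_cast
    ring
  · ring

/-- Determinant expression for the polynomial `p_ℓ` in the quadratic relation
`J_ℓ² = p_ℓ(H_ℓ; g, Δ)`, conditional on the conjecture
`p_ℓ(N + ℓ/2 − g²; g, Δ) = A_N^ℓ((2g)², Δ²)`: a real polynomial of degree at most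
`ℓ` agreeing with `A_N^ℓ((2g)², Δ²)` at `x = N + ℓ/2 − g²` for `0 ≤ N ≤ ℓ` equals
`det(Δ²·I_ℓ + M_ℓ(x, g))` everywhere. -/
theorem stmt9 (ℓ : ℕ) (g Δ : ℝ) (p : Polynomial ℝ) (hdeg : p.natDegree ≤ ℓ)
    (h : ∀ N : ℕ, N ≤ ℓ →
      p.eval ((N : ℝ) + (ℓ : ℝ) / 2 - g ^ 2) = Apoly ℓ N ((2 * g) ^ 2) (Δ ^ 2)) :
    ∀ x : ℝ, p.eval x
      = (Δ ^ 2 • (1 : Matrix (Fin ℓ) (Fin ℓ) ℝ) + Mmat ℓ x g).det := by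
  obtain ⟨q, hq, hqx⟩ := exists_polynomial_eval_eq_det_add_Mmat ℓ g
    (Δ ^ 2 • (1 : Matrix (Fin ℓ) (Fin ℓ) ℝ))
  suffices hpq : p = q from fun x => by rw [hpq, hqx]
  refine Polynomial.eq_of_natDegree_lt_card_of_eval_eq p q
    (f := fun N : Fin (ℓ + 1) => ((N : ℕ) : ℝ) + (ℓ : ℝ) / 2 - g ^ 2) ?_ ?_ ?_
  · intro a b hab
    simpa [Fin.ext_iff] using hab
  · intro N
    rw [h N (Nat.lt_succ_iff.mp N.isLt), hqx, Apoly_eq_det]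
  · rw [Fintype.card_fin]
    omega
end

section
/- For every ℓ ∈ ℕ and every element u of a commutative ring, the determinant of the ℓ×ℓ tridiagonal matrix with (i,i)-entry u − ℓ + 2i − 1 for 1 ≤ i ≤ ℓ, (i,i+1)-entry 1, (i+1,i)-entry −i(ℓ−i), and all other entries 0, equals u^ℓ. -/
/-- The tridiagonal `n × n` matrix with diagonal `a`, superdiagonal `b` and subdiagonal `c`. -/
def tridiagonal {R : Type*} [Zero R] (a b c : ℕ → R) (n : ℕ) : Matrix (Fin n) (Fin n) R :=
  Matrix.of fun i j =>
    if (i : ℕ) = (j : ℕ) then a i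
    else if (j : ℕ) = (i : ℕ) + 1 then b i
    else if (i : ℕ) = (j : ℕ) + 1 then c j
    else 0

/-- The three-term recurrence for tridiagonal determinants. -/
theorem det_tridiagonal_add_two {R : Type*} [CommRing R] (a b c : ℕ → R) (n : ℕ) :
    (tridiagonal a b c (n + 2)).det =
      a (n + 1) * (tridiagonal a b c (n + 1)).det - b n * c n * (tridiagonal a b c n).det := by
  have minor : ((tridiagonal a b c (n + 2)).submatrix (Fin.last (n + 1)).succAbove
      (Fin.last n).castSucc.succAbove).det = b n * (tridiagonal a b c n).det := by
    rw [Matrix.det_succ_column _ (Fin.last n), Fin.sum_univ_castSucc, Finset.sum_eq_zero]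
    · have h : (((tridiagonal a b c (n + 2)).submatrix (Fin.last (n + 1)).succAbove
          (Fin.last n).castSucc.succAbove).submatrix (Fin.last n).succAbove
          (Fin.last n).succAbove) = tridiagonal a b c n := by
        ext i j
        have hj : (Fin.last n).castSucc.succAbove j.castSucc = j.castSucc.castSucc :=
          Fin.succAbove_of_castSucc_lt _ _ (by simp [Fin.lt_def])
        simp [tridiagonal, hj]
      rw [h]
      simp [tridiagonal, ← two_mul]
    · intro i _
      have := i.isLt
      simp [tridiagonal, show (i : ℕ) ≠ n + 1 by omega, show n ≠ (i : ℕ) by omega,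
        show (i : ℕ) ≠ n + 1 + 1 by omega]
  rw [Matrix.det_succ_row _ (Fin.last (n + 1)), Fin.sum_univ_castSucc, Fin.sum_univ_castSucc,
    Finset.sum_eq_zero, minor]
  · have h : ((tridiagonal a b c (n + 2)).submatrix (Fin.last (n + 1)).succAbove
        (Fin.last (n + 1)).succAbove) = tridiagonal a b c (n + 1) := by
      ext i j
      simp [tridiagonal]
    rw [h]
    have hs : (-1 : R) ^ (n + 1 + n) = -1 := Odd.neg_one_pow ⟨n, by ring⟩
    simp [tridiagonal, ← two_mul, hs, show n ≠ n + 1 + 1 by omega]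
    ring
  · intro i _
    have := i.isLt
    simp [tridiagonal, show n + 1 ≠ (i : ℕ) by omega, show (i : ℕ) ≠ n + 1 + 1 by omega,
      show n ≠ (i : ℕ) by omega]

/-- The polynomial `∑ j, (-1) ^ j * k.choose j * m (m + 1) ⋯ (m + j - 1) * u ^ (k - j)`, defined
by Pascal's rule. -/
def risingBinomial {R : Type*} [CommRing R] (u : R) : ℕ → R → R
  | 0, _ => 1
  | k + 1, m => u * risingBinomial u k m - m * risingBinomial u k (m + 1)

theorem risingBinomial_zero_right {R : Type*} [CommRing R] (u : R) (k : ℕ) :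
    risingBinomial u k 0 = u ^ k := by
  induction k with
  | zero => simp [risingBinomial]
  | succ k ih => rw [risingBinomial, ih]; ring

theorem risingBinomial_succ_sub {R : Type*} [CommRing R] (u : R) (k : ℕ) (m : R) :
    risingBinomial u (k + 1) m - risingBinomial u (k + 1) (m + 1) =
      (k + 1) * risingBinomial u k (m + 1) := by
  induction k generalizing m with
  | zero => simp [risingBinomial]
  | succ k ih =>
    have h₁ := ih m
    have h₂ := ih (m + 1)
    have h₃ : risingBinomial u (k + 1) (m + 1) = u * risingBinomial u k (m + 1) -
      (m + 1) * risingBinomial u k (m + 1 + 1) := rfl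
    have h₄ : risingBinomial u (k + 2) (m + 1) = u * risingBinomial u (k + 1) (m + 1) -
      (m + 1) * risingBinomial u (k + 1) (m + 1 + 1) := rfl
    rw [risingBinomial, h₄]
    push_cast
    linear_combination u * h₁ - (m + 1) * h₂ - (k + 1) * h₃

theorem risingBinomial_add_two {R : Type*} [CommRing R] (u : R) (k : ℕ) (m : R) :
    risingBinomial u (k + 2) m = (u - m + k + 1) * risingBinomial u (k + 1) (m + 1) +
      (k + 1) * (m + 1) * risingBinomial u k (m + 1 + 1) := by
  have h₁ := risingBinomial_succ_sub u k m
  have h₂ : risingBinomial u (k + 1) (m + 1) = u * risingBinomial u k (m + 1) -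
    (m + 1) * risingBinomial u k (m + 1 + 1) := rfl
  rw [risingBinomial]
  linear_combination u * h₁ - (k + 1) * h₂

theorem det_tridiagonal_eq_risingBinomial {R : Type*} [CommRing R] (u x : R) (k : ℕ) :
    (tridiagonal (fun i => u - x + 2 * ((i : R) + 1) - 1) (fun _ => 1)
      (fun j => -(((j : R) + 1) * (x - ((j : R) + 1)))) k).det = risingBinomial u k (x - k) := by
  induction k using Nat.twoStepInduction with
  | zero => simp [risingBinomial]
  | one => simp [tridiagonal, risingBinomial]; ring
  | more k ih₁ ih₂ =>
    rw [det_tridiagonal_add_two, ih₁, ih₂, risingBinomial_add_two]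
    have e₁ : x - ((k + 2 : ℕ) : R) + 1 = x - ((k + 1 : ℕ) : R) := by push_cast; ring
    have e₂ : x - ((k + 1 : ℕ) : R) + 1 = x - (k : R) := by push_cast; ring
    rw [e₁, e₂]
    push_cast
    ring

/-- The determinant of the `ℓ×ℓ` tridiagonal matrix with diagonal entries
`u − ℓ + 2i − 1` (`1 ≤ i ≤ ℓ`), superdiagonal entries `1` and subdiagonal entries
`−i(ℓ−i)` equals `u^ℓ`. -/
theorem stmt10 (R : Type*) [CommRing R] (ℓ : ℕ) (u : R) :
    (Matrix.of fun i j : Fin ℓ =>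
      if (i : ℕ) = (j : ℕ) then
        u - (ℓ : R) + 2 * (((i : ℕ) : R) + 1) - 1
      else if (j : ℕ) = (i : ℕ) + 1 then 1
      else if (i : ℕ) = (j : ℕ) + 1 then
        -((((j : ℕ) : R) + 1) * ((ℓ : R) - (((j : ℕ) : R) + 1)))
      else 0).det = u ^ ℓ := by
  have h := det_tridiagonal_eq_risingBinomial u (ℓ : R) ℓ
  rw [sub_self, risingBinomial_zero_right] at h
  exact h
end

section
/- Let ℓ ≥ 1 be a natural number and let g, Δ, x be real numbers with 4g² > ℓ − 1 and x > ℓ/2 − 1 − g². Then det(Δ²·I_ℓ + M_ℓ(x, g)) > 0. (Positivity of the symmetry polynomial p_ℓ(x; g, Δ) above the line x = ℓ/2 − 1 − g² in the strong-coupling regime.) -/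
namespace Matrix

/-- Three-term recurrence for the determinant of a tridiagonal matrix. -/
theorem det_tridiagonal_succ_succ {R : Type*} [CommRing R] {n : ℕ}
    (A : Matrix (Fin (n + 2)) (Fin (n + 2)) R)
    (hA : ∀ i j : Fin (n + 2), (i : ℕ) + 1 < j → A i j = 0 ∧ A j i = 0) :
    A.det = A 0 0 * (A.submatrix Fin.succ Fin.succ).det -
      A 0 1 * A 1 0 *
        (A.submatrix (fun i : Fin n => i.succ.succ) fun i : Fin n => i.succ.succ).det := by
  have hminor : (A.submatrix Fin.succ (Fin.succAbove 1)).det = A 1 0 *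
      (A.submatrix (fun i : Fin n => i.succ.succ) fun i : Fin n => i.succ.succ).det := by
    rw [det_succ_column_zero, Fin.sum_univ_succ, Finset.sum_eq_zero]
    · have hcol : ((Fin.succAbove 1 : Fin (n + 1) → Fin (n + 2)) ∘ Fin.succ) =
          fun i : Fin n => i.succ.succ := by
        funext i
        exact Fin.succ_succAbove_succ 0 i
      simp only [submatrix_submatrix, Fin.succAbove_zero, hcol]
      simp [Function.comp_def]
    · intro i _
      have h : A i.succ.succ 0 = 0 := (hA 0 i.succ.succ (by simp)).2
      simp [h]
  rw [det_succ_row_zero, Fin.sum_univ_succ, Fin.sum_univ_succ, Finset.sum_eq_zero]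
  · simp only [Fin.succ_zero_eq_one, hminor, Fin.succAbove_zero]
    simp
    ring
  · intro i _
    rw [(hA 0 i.succ.succ (by simp)).1]
    simp

/-- A real tridiagonal matrix with positive diagonal entries and nonpositive products of paired
off-diagonal entries has positive determinant. -/
theorem det_pos_of_tridiagonal {n : ℕ} (A : Matrix (Fin n) (Fin n) ℝ)
    (hzero : ∀ i j : Fin n, (i : ℕ) + 1 < j → A i j = 0 ∧ A j i = 0)
    (hdiag : ∀ i, 0 < A i i)
    (hoff : ∀ i j : Fin n, (j : ℕ) = i + 1 → A i j * A j i ≤ 0) : 0 < A.det := by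
  induction n using Nat.twoStepInduction with
  | zero => simp
  | one => simpa using hdiag 0
  | more n ih₀ ih₁ =>
    have h₁ : 0 < (A.submatrix Fin.succ Fin.succ).det :=
      ih₁ _ (fun i j h => hzero _ _ (by simpa using h)) (fun i => hdiag _)
        fun i j h => hoff _ _ (by simpa using h)
    have h₀ : 0 < (A.submatrix (fun i : Fin n => i.succ.succ) fun i => i.succ.succ).det :=
      ih₀ _ (fun i j h => hzero _ _ (by simpa using h)) (fun i => hdiag _)
        fun i j h => hoff _ _ (by simpa using h)
    rw [det_tridiagonal_succ_succ A hzero]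
    linarith [mul_pos (hdiag 0) h₁,
      mul_nonpos_of_nonpos_of_nonneg (hoff 0 1 (by simp)) h₀.le]

end Matrix

/-- Positivity of the symmetry polynomial `p_ℓ(x; g, Δ) = det(Δ²·I_ℓ + M_ℓ(x, g))`
above the line `x = ℓ/2 − 1 − g²` in the strong-coupling regime `4g² > ℓ − 1`. -/
theorem stmt12 (ℓ : ℕ) (hℓ : 1 ≤ ℓ) (g Δ x : ℝ)
    (hg : (ℓ : ℝ) - 1 < 4 * g ^ 2)
    (hx : (ℓ : ℝ) / 2 - 1 - g ^ 2 < x) :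
    0 < (Δ ^ 2 • (1 : Matrix (Fin ℓ) (Fin ℓ) ℝ) + Mmat ℓ x g).det := by
  have hshift (k : ℕ) : 0 < x - (ℓ : ℝ) / 2 + g ^ 2 + ((k : ℝ) + 1) := by
    have : (0 : ℝ) ≤ k := k.cast_nonneg
    linarith
  refine Matrix.det_pos_of_tridiagonal _ ?_ ?_ ?_
  · intro i j h
    have hij : i ≠ j := by
      rintro rfl
      omega
    have h₁ : (i : ℕ) ≠ j := by omega
    have h₂ : (j : ℕ) ≠ i + 1 := by omega
    have h₃ : (i : ℕ) ≠ j + 1 := by omega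
    simp [Mmat, hij, hij.symm, h₁, h₁.symm, h₂, h₃]
  · intro i
    have hi : (0 : ℝ) ≤ (i : ℕ) := Nat.cast_nonneg _
    have hfac : 0 < (2 * g) ^ 2 - (ℓ : ℝ) + 2 * (((i : ℕ) : ℝ) + 1) - 1 := by nlinarith
    have hprod := mul_pos hfac (hshift i)
    simp only [Mmat, Matrix.add_apply, Matrix.smul_apply, Matrix.one_apply_eq, Matrix.of_apply,
      if_true, smul_eq_mul, mul_one]
    positivity
  · intro i j h
    have hij : i ≠ j := by
      rintro rfl
      omega
    have h₁ : (i : ℕ) ≠ j := by omega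
    have h₂ : (i : ℕ) ≠ j + 1 := by omega
    have hi : ((i : ℕ) : ℝ) + 1 ≤ ℓ := by exact_mod_cast i.isLt
    have hup : (Δ ^ 2 • (1 : Matrix (Fin ℓ) (Fin ℓ) ℝ) + Mmat ℓ x g) i j =
        x - (ℓ : ℝ) / 2 + g ^ 2 + (((i : ℕ) : ℝ) + 1) := by
      simp [Mmat, hij, h]
    have hlow : (Δ ^ 2 • (1 : Matrix (Fin ℓ) (Fin ℓ) ℝ) + Mmat ℓ x g) j i =
        -((((i : ℕ) : ℝ) + 1) * ((ℓ : ℝ) - (((i : ℕ) : ℝ) + 1)))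
          * (x - (ℓ : ℝ) / 2 + g ^ 2 + (((i : ℕ) : ℝ) + 1) + 1) := by
      simp only [Mmat, Matrix.add_apply, Matrix.smul_apply, Matrix.one_apply_ne hij.symm,
        Matrix.of_apply, if_neg h₁.symm, if_neg h₂, if_pos h, smul_zero, zero_add]
    rw [hup, hlow]
    have hpos := hshift i
    have hc : 0 ≤ (((i : ℕ) : ℝ) + 1) * ((ℓ : ℝ) - (((i : ℕ) : ℝ) + 1)) :=
      mul_nonneg (by positivity) (sub_nonneg.2 hi)
    exact mul_nonpos_of_nonneg_of_nonpos hpos.le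
      (mul_nonpos_of_nonpos_of_nonneg (neg_nonpos.2 hc) (by linarith))
end

section
/- Let g, Δ be complex numbers with Δ ≠ 0, set A = 16g² and B = 192Δ², and suppose the discriminant condition (3A² − B)³ = 324B² holds. Then the cubic X³ − 27(3A² − B)X + 972B ∈ ℂ[X] has a root of multiplicity exactly 2: there exist r, s ∈ ℂ with r ≠ s such that X³ − 27(3A² − B)X + 972B = (X − r)²(X − s). (Hence the corresponding fiber of the elliptic surface attached to the ℓ = 3 asymmetric quantum Rabi model is a nodal cubic, i.e. of Kodaira type I₁, never a cusp.) -/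
open Polynomial

/-- If `Δ ≠ 0`, `A = 16g²`, `B = 192Δ²` and the discriminant condition
`(3A² − B)³ = 324B²` holds, then the cubic `X³ − 27(3A² − B)X + 972B ∈ ℂ[X]`
has a root of multiplicity exactly 2: the corresponding singular fiber of the
elliptic surface attached to the `ℓ = 3` asymmetric quantum Rabi model is a
nodal cubic (Kodaira type `I₁`), never a cusp. -/
theorem stmt18 (g Δ : ℂ) (hΔ : Δ ≠ 0) (A B : ℂ)
    (hA : A = 16 * g ^ 2) (hB : B = 192 * Δ ^ 2)
    (hdisc : (3 * A ^ 2 - B) ^ 3 = 324 * B ^ 2) :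
    ∃ r s : ℂ, r ≠ s ∧
      Polynomial.X ^ 3 - C (27 * (3 * A ^ 2 - B)) * Polynomial.X + C (972 * B)
        = (Polynomial.X - C r) ^ 2 * (Polynomial.X - C s) := by
  have hB0 : B ≠ 0 := by
    rw [hB]
    exact mul_ne_zero (by norm_num) (pow_ne_zero 2 hΔ)
  generalize 3 * A ^ 2 - B = P at hdisc ⊢
  have hP0 : P ≠ 0 := by
    rintro rfl
    have : (324 : ℂ) * B ^ 2 ≠ 0 := mul_ne_zero (by norm_num) (pow_ne_zero 2 hB0)
    exact this (by rw [← hdisc]; norm_num)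
  obtain ⟨r, hr⟩ : ∃ r : ℂ, r * P = 54 * B := ⟨54 * B / P, div_mul_cancel₀ _ hP0⟩
  have hr0 : r ≠ 0 := by
    rintro rfl
    rw [zero_mul] at hr
    exact mul_ne_zero (by norm_num) hB0 hr.symm
  have hlin : 27 * P = 3 * r ^ 2 := by
    apply mul_right_cancel₀ (pow_ne_zero 2 hP0)
    linear_combination 27 * hdisc - 3 * (r * P + 54 * B) * hr
  have hconst : 972 * B = 2 * r ^ 3 := by
    linear_combination (-18) * hr + (2 / 3) * r * hlin
  refine ⟨r, -2 * r, fun h => hr0 (by linear_combination h / 3), ?_⟩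
  rw [hlin, hconst]
  simp only [map_mul, map_pow, map_neg, map_ofNat]
  ring
end
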